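/- arXiv:2101.03629 — 3 statements merged into one kernel-verified Lean document; each statement's English description precedes it below -/
import Mathlib

section
/- Let m ∈ ℕ and s ∈ (m−1, m). Then for every u ∈ ℓ²(ℤ) the integral ∫_0^∞ z^{−s+m−2} ‖(S_z(Δ) − I)((−Δ)^{m−1} u)‖₂ dz is finite; consequently ‖ (1/Γ(−(s−m+1))) ∫_0^∞ z^{−s+m−2} (S_z(Δ) − I)((−Δ)^{m−1} u) dz ‖₂ < ∞, so the discrete fractional Laplace operator of order s is well-defined on ℓ²(ℤ). -/
/-- The discrete heat semigroup applied to `u : ℤ → ℝ` at time `z` and site `n`. -/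
noncomputable def heatS (z : ℝ) (u : ℤ → ℝ) (n : ℤ) : ℝ :=
  ∑' k : ℤ, Real.exp (-(2 * z)) *
    (∑' j : ℕ, z ^ (2 * (j : ℤ) + (n - k)) /
      (Real.Gamma (1 + (j : ℝ)) * Real.Gamma ((j : ℝ) + ((n - k : ℤ) : ℝ) + 1))) * u k

/-- The negative discrete Laplace operator `(−Δu)(n) = 2u(n) − u(n−1) − u(n+1)`. -/
def negLap (u : ℤ → ℝ) : ℤ → ℝ := fun n => 2 * u n - u (n - 1) - u (n + 1)

open MeasureTheory Set Filter Topology Asymptotics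

/-- The real Hilbert space `ℓ²(ℤ)`. -/
abbrev EllTwo : Type := lp (fun _ : ℤ => ℝ) 2

theorem memℓp_two_iff_summable_sq {f : ℤ → ℝ} :
    Memℓp f 2 ↔ Summable fun k => f k ^ 2 := by
  rw [memℓp_gen_iff (by norm_num)]
  simp

theorem EllTwo.norm_eq_sqrt (f : EllTwo) : ‖f‖ = Real.sqrt (∑' n, f n ^ 2) := by
  rw [lp.norm_eq_tsum_rpow (by norm_num), Real.sqrt_eq_rpow]
  simp

/-- Translation by `d` on `ℓ²(ℤ)`. -/
noncomputable def shift (d : ℤ) : EllTwo →ₗᵢ[ℝ] EllTwo where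
  toFun f := ⟨fun n => f (n - d), memℓp_two_iff_summable_sq.2
    ((Equiv.subRight d).summable_iff.2 (memℓp_two_iff_summable_sq.1 (lp.memℓp f)))⟩
  map_add' _ _ := rfl
  map_smul' _ _ := rfl
  norm_map' f := by
    rw [EllTwo.norm_eq_sqrt, EllTwo.norm_eq_sqrt]
    exact congrArg Real.sqrt ((Equiv.subRight d).tsum_eq fun n => f n ^ 2)

/-- Translation by `d`, as an element of the Banach algebra of bounded operators. -/
noncomputable def shiftCLM (d : ℤ) : EllTwo →L[ℝ] EllTwo := (shift d).toContinuousLinearMap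

theorem shiftCLM_apply (d : ℤ) (f : EllTwo) (n : ℤ) : shiftCLM d f n = f (n - d) := rfl

theorem shiftCLM_pow_apply (d : ℤ) (i : ℕ) (f : EllTwo) (n : ℤ) :
    (shiftCLM d ^ i) f n = f (n - i * d) := by
  induction i generalizing n with
  | zero => simp
  | succ i ih =>
    rw [pow_succ', mul_apply_eq_comp, shiftCLM_apply, ih]
    rw [show n - d - i * d = n - (i + 1 : ℕ) * d by push_cast; ring]

theorem norm_shiftCLM_pow_le (d : ℤ) (i : ℕ) : ‖shiftCLM d ^ i‖ ≤ 1 := by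
  induction i with
  | zero => exact ContinuousLinearMap.norm_id_le
  | succ i ih =>
    rw [pow_succ]
    exact (norm_mul_le _ _).trans
      (mul_le_one₀ ih (norm_nonneg _) (shift d).norm_toContinuousLinearMap_le)

theorem norm_exp_smul_shiftCLM_le (d : ℤ) {z : ℝ} (hz : 0 ≤ z) :
    ‖NormedSpace.exp (z • shiftCLM d)‖ ≤ Real.exp z := by
  have h1 := NormedSpace.exp_series_hasSum_exp' (𝕂 := ℝ) (z • shiftCLM d)
  have h2 := NormedSpace.exp_series_hasSum_exp' (𝕂 := ℝ) z
  rw [← h1.tsum_eq, Real.exp_eq_exp_ℝ]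
  refine tsum_of_norm_bounded h2 fun i => ?_
  rw [smul_pow, norm_smul, norm_smul, norm_inv, norm_pow, Real.norm_natCast, smul_eq_mul,
    Real.norm_of_nonneg hz]
  have := norm_shiftCLM_pow_le d i
  gcongr
  exact mul_le_of_le_one_right (by positivity) this

/-- The heat semigroup as a bounded operator on `ℓ²(ℤ)`. -/
noncomputable def heatCLM (z : ℝ) : EllTwo →L[ℝ] EllTwo :=
  Real.exp (-(2 * z)) • (NormedSpace.exp (z • shiftCLM 1) * NormedSpace.exp (z • shiftCLM (-1)))

theorem norm_heatCLM_le {z : ℝ} (hz : 0 ≤ z) : ‖heatCLM z‖ ≤ 1 := by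
  rw [heatCLM, norm_smul, Real.norm_of_nonneg (Real.exp_nonneg _)]
  calc _ ≤ Real.exp (-(2 * z)) * (Real.exp z * Real.exp z) := by
        gcongr
        exact (norm_mul_le _ _).trans (mul_le_mul (norm_exp_smul_shiftCLM_le _ hz)
          (norm_exp_smul_shiftCLM_le _ hz) (norm_nonneg _) (Real.exp_nonneg _))
    _ = 1 := by
        rw [← Real.exp_add, ← Real.exp_add]
        simp [two_mul]

theorem differentiable_heatCLM : Differentiable ℝ heatCLM := by
  have h (d : ℤ) : Differentiable ℝ fun z : ℝ => NormedSpace.exp (z • shiftCLM d) :=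
    fun z => (hasDerivAt_exp_smul_const (𝕂 := ℝ) (shiftCLM d) z).differentiableAt
  have h' : Differentiable ℝ fun z : ℝ => Real.exp (-(2 * z)) := by fun_prop
  exact h'.smul ((h 1).mul (h (-1)))

theorem heatCLM_zero : heatCLM 0 = 1 := by
  simp [heatCLM]

/-- The functional `T ↦ (T f) n` on the bounded operators of `ℓ²(ℤ)`. -/
noncomputable def matrixCoeff (f : EllTwo) (n : ℤ) : (EllTwo →L[ℝ] EllTwo) →L[ℝ] ℝ :=
  (lp.evalCLM ℝ (fun _ : ℤ => ℝ) 2 n).comp (ContinuousLinearMap.apply ℝ EllTwo f)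

theorem matrixCoeff_apply (f : EllTwo) (n : ℤ) (T : EllTwo →L[ℝ] EllTwo) :
    matrixCoeff f n T = T f n := rfl

theorem matrixCoeff_shiftCLM_pow_mul_pow (f : EllTwo) (n : ℤ) (i j : ℕ) :
    matrixCoeff f n (shiftCLM 1 ^ i * shiftCLM (-1) ^ j) = f (n - i + j) := by
  rw [matrixCoeff_apply, mul_apply_eq_comp, shiftCLM_pow_apply, shiftCLM_pow_apply]
  rw [show n - (i : ℤ) * 1 - (j : ℤ) * (-1) = n - i + j by ring]

theorem hasSum_exp_smul_mul_exp_smul {A : Type*} [NormedRing A] [NormedAlgebra ℝ A]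
    [CompleteSpace A] (x y : A) (z : ℝ) :
    HasSum (fun p : ℕ × ℕ => (z ^ (p.1 + p.2) / (p.1.factorial * p.2.factorial)) •
        (x ^ p.1 * y ^ p.2))
      (NormedSpace.exp (z • x) * NormedSpace.exp (z • y)) := by
  have hx := NormedSpace.exp_series_hasSum_exp' (𝕂 := ℝ) (z • x)
  have hy := NormedSpace.exp_series_hasSum_exp' (𝕂 := ℝ) (z • y)
  have hxy := summable_mul_of_summable_norm
    (NormedSpace.norm_expSeries_summable' (𝕂 := ℝ) (z • x))
    (NormedSpace.norm_expSeries_summable' (𝕂 := ℝ) (z • y))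
  have h := hx.mul hy hxy
  refine h.congr_fun fun p => ?_
  rw [smul_pow, smul_pow, smul_smul, smul_smul, smul_mul_smul_comm]
  congr 1
  rw [pow_add]
  field_simp

theorem hasSum_exp_shiftCLM_mul_apply (z : ℝ) (f : EllTwo) (n : ℤ) :
    HasSum (fun p : ℕ × ℕ => z ^ (p.1 + p.2) / (p.1.factorial * p.2.factorial) *
        f (n - p.1 + p.2))
      ((NormedSpace.exp (z • shiftCLM 1) * NormedSpace.exp (z • shiftCLM (-1))) f n) := by
  rw [← matrixCoeff_apply]
  refine ((hasSum_exp_smul_mul_exp_smul (shiftCLM 1) (shiftCLM (-1)) z).mapL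
    (matrixCoeff f n)).congr_fun fun p => ?_
  rw [map_smul, matrixCoeff_shiftCLM_pow_mul_pow, smul_eq_mul]

theorem heatS_eq_heatCLM_apply (z : ℝ) (f : EllTwo) (n : ℤ) :
    heatS z f n = heatCLM z f n := by
  set F : ℤ × ℕ → ℝ := fun p => z ^ (2 * (p.2 : ℤ) + (n - p.1)) /
      (Real.Gamma (1 + (p.2 : ℝ)) * Real.Gamma ((p.2 : ℝ) + ((n - p.1 : ℤ) : ℝ) + 1)) * f p.1
    with hF
  set g : ℕ × ℕ → ℤ × ℕ := fun p => (n - p.1 + p.2, p.2) with hg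
  have hinj : Function.Injective g := by
    rintro ⟨i, j⟩ ⟨i', j'⟩ h
    simp only [hg, Prod.mk.injEq] at h
    ext <;> simp <;> omega
  have hzero : ∀ p ∉ range g, F p = 0 := by
    rintro ⟨k, j⟩ hp
    have hneg : (j : ℤ) + (n - k) < 0 := by
      by_contra! hcon
      refine hp ⟨(((j : ℤ) + (n - k)).toNat, j), ?_⟩
      simp only [hg, Prod.mk.injEq, and_true]
      omega
    obtain ⟨r, hr⟩ := Int.eq_ofNat_of_zero_le (show 0 ≤ -((j : ℤ) + (n - k) + 1) by omega)
    have hG : Real.Gamma ((j : ℝ) + ((n - k : ℤ) : ℝ) + 1) = 0 := by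
      have : (j : ℝ) + ((n - k : ℤ) : ℝ) + 1 = -(r : ℝ) := by
        have := congrArg (fun x : ℤ => (x : ℝ)) hr
        push_cast at this ⊢
        linarith
      rw [this, Real.Gamma_neg_nat_eq_zero]
    simp only [hF, hG, mul_zero, div_zero, zero_mul]
  have hcomp : F ∘ g = fun p : ℕ × ℕ => z ^ (p.1 + p.2) /
      (p.1.factorial * p.2.factorial) * f (n - p.1 + p.2) := by
    ext ⟨i, j⟩
    have e1 : 2 * (j : ℤ) + (n - (n - i + j)) = ((i + j : ℕ) : ℤ) := by push_cast; ring
    have e2 : (j : ℝ) + ((n - (n - i + j) : ℤ) : ℝ) + 1 = (i : ℝ) + 1 := by push_cast; ring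
    simp only [hF, hg, Function.comp_apply, e1, e2, zpow_natCast, add_comm (1 : ℝ),
      Real.Gamma_nat_eq_factorial]
    rw [mul_comm (j.factorial : ℝ)]
  have hsum := hasSum_exp_shiftCLM_mul_apply z f n
  rw [← hcomp, hinj.hasSum_iff hzero] at hsum
  have hrow : heatS z f n = Real.exp (-(2 * z)) * ∑' k : ℤ, ∑' j : ℕ, F (k, j) := by
    simp only [heatS, hF, tsum_mul_right, mul_assoc, tsum_mul_left]
  rw [hrow, ← hsum.summable.tsum_prod, hsum.tsum_eq]
  rfl

theorem exists_ellTwo_eq_negLap_iterate (k : ℕ) (f : EllTwo) :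
    ∃ g : EllTwo, ⇑g = negLap^[k] f := by
  induction k with
  | zero => exact ⟨f, rfl⟩
  | succ k ih =>
    obtain ⟨g, hg⟩ := ih
    refine ⟨(2 : ℝ) • g - shiftCLM 1 g - shiftCLM (-1) g, ?_⟩
    rw [Function.iterate_succ_apply', ← hg]
    ext n
    simp only [lp.coeFn_sub, lp.coeFn_smul, Pi.sub_apply, Pi.smul_apply, smul_eq_mul,
      shiftCLM_apply, sub_neg_eq_add, negLap]

theorem integrableOn_rpow_mul_norm_heatCLM_sub (f : EllTwo) {a : ℝ} (ha0 : 0 < a) (ha1 : a < 1) :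
    IntegrableOn (fun z : ℝ => z ^ (-a - 1) * ‖heatCLM z f - f‖) (Ioi 0) := by
  have hd : Differentiable ℝ fun z => heatCLM z f :=
    differentiable_heatCLM.clm_apply (differentiable_const f)
  have hc : Continuous fun z => ‖heatCLM z f - f‖ := (hd.continuous.sub continuous_const).norm
  refine mellin_convergent_of_isBigO_scalar (a := 0) (b := -1)
    (hc.locallyIntegrable.locallyIntegrableOn _)
    ?_ (by linarith) ?_ (by linarith)
  · refine IsBigO.of_bound (2 * ‖f‖) ?_
    filter_upwards [eventually_ge_atTop 0] with z hz
    have h1 : ‖heatCLM z f‖ ≤ ‖f‖ := by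
      simpa using (heatCLM z).le_of_opNorm_le (norm_heatCLM_le hz) f
    simp only [norm_norm, neg_zero, Real.rpow_zero, norm_one, mul_one]
    linarith [norm_sub_le (heatCLM z f) f]
  · have h := (hd 0).isBigO_sub.norm_left.mono (nhdsWithin_le_nhds (s := Ioi 0))
    simpa [heatCLM_zero] using h

/-- Let `m ∈ ℕ` and `s ∈ (m−1, m)`. Then for every `u ∈ ℓ²(ℤ)` the
integral `∫_0^∞ z^{−s+m−2} ‖(S_z(Δ) − I)((−Δ)^{m−1}u)‖₂ dz` is finite, and the
(pointwise-defined) function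
`n ↦ (1/Γ(−(s−m+1))) ∫_0^∞ z^{−s+m−2} [(S_z(Δ) − I)((−Δ)^{m−1}u)](n) dz`
belongs to `ℓ²(ℤ)`; i.e., the discrete fractional Laplace operator of order `s`
is well-defined on `ℓ²(ℤ)`. -/
theorem stmt8 (m : ℕ) (hm : 1 ≤ m) (s : ℝ) (hs1 : (m : ℝ) - 1 < s) (hs2 : s < m)
    (u : ℤ → ℝ) (hu : Summable (fun k : ℤ => (u k) ^ 2)) :
    MeasureTheory.IntegrableOn
      (fun z : ℝ => z ^ (-s + (m : ℝ) - 2) *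
        Real.sqrt (∑' n : ℤ, (heatS z (negLap^[m - 1] u) n - negLap^[m - 1] u n) ^ 2))
      (Set.Ioi 0) ∧
    Summable (fun n : ℤ =>
      ((1 / Real.Gamma (-(s - (m : ℝ) + 1))) *
        ∫ z in Set.Ioi (0 : ℝ), z ^ (-s + (m : ℝ) - 2) *
          (heatS z (negLap^[m - 1] u) n - negLap^[m - 1] u n)) ^ 2) := by
  set a : ℝ := s - m + 1 with ha
  obtain ⟨v, hv⟩ := exists_ellTwo_eq_negLap_iterate (m - 1) ⟨u, memℓp_two_iff_summable_sq.2 hu⟩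
  replace hv : ⇑v = negLap^[m - 1] u := hv
  rw [← hv, show -s + (m : ℝ) - 2 = -a - 1 by rw [ha]; ring]
  have hcoord (z : ℝ) (n : ℤ) : heatS z v n - v n = (heatCLM z v - v) n := by
    rw [heatS_eq_heatCLM_apply]
    rfl
  have hnorm := integrableOn_rpow_mul_norm_heatCLM_sub v (a := a) (by linarith) (by linarith)
  refine ⟨hnorm.congr_fun (fun z _ => ?_) measurableSet_Ioi, ?_⟩
  · simp only [EllTwo.norm_eq_sqrt, hcoord]
  have hint : IntegrableOn (fun z : ℝ => z ^ (-a - 1) • (heatCLM z v - v)) (Ioi 0) := by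
    refine hnorm.mono' ?_ ?_
    · refine ContinuousOn.aestronglyMeasurable ?_ measurableSet_Ioi
      have hc : Continuous fun z => heatCLM z v - v :=
        (differentiable_heatCLM.clm_apply (differentiable_const v)).continuous.sub continuous_const
      exact ContinuousOn.smul (fun z hz => (Real.continuousAt_rpow_const z _
        (Or.inl (ne_of_gt hz))).continuousWithinAt) hc.continuousOn
    · filter_upwards [ae_restrict_mem measurableSet_Ioi] with z hz
      rw [norm_smul, Real.norm_of_nonneg (Real.rpow_nonneg (le_of_lt hz) _)]
  have hsummable := memℓp_two_iff_summable_sq.1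
    (lp.memℓp ((1 / Real.Gamma (-a)) • ∫ z in Ioi (0 : ℝ), z ^ (-a - 1) • (heatCLM z v - v)))
  convert hsummable using 3 with n
  rw [lp.coeFn_smul, Pi.smul_apply, smul_eq_mul]
  congr 1
  refine Eq.trans ?_ ((lp.evalCLM ℝ (fun _ : ℤ => ℝ) 2 n).integral_comp_comm hint)
  simp only [hcoord]
  rfl
end

section
/- For every m ∈ ℕ, every s ∈ (m−1, m), and every k ∈ ℤ with k ≠ 0 it holds that K_s(k) = (−1)^{k+1} Γ(2s + 1) / (Γ(1 + s + k) Γ(1 + s − k)); moreover K_s(0) = 0. -/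
/-- The fractional kernel `K_s : ℤ → ℝ`, defined by `K_s(0) = 0` and
`K_s(k) = −4^s Γ(1/2 + s) Γ(|k| − s) / (√π Γ(−s) Γ(|k| + 1 + s))` for `k ≠ 0`. -/
noncomputable def fracKer (s : ℝ) (k : ℤ) : ℝ :=
  if k = 0 then 0
  else -((4 : ℝ) ^ s * Real.Gamma (1 / 2 + s) * Real.Gamma (|(k : ℝ)| - s)) /
    (Real.sqrt Real.pi * Real.Gamma (-s) * Real.Gamma (|(k : ℝ)| + 1 + s))

namespace Real

lemma Gamma_ne_zero_of_not_int {x : ℝ} (hx : ∀ j : ℤ, x ≠ j) : Gamma x ≠ 0 :=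
  Gamma_ne_zero fun j => by simpa using hx (-(j : ℤ))

/-- Integer shifts in the reflection formula only change the sign. -/
lemma Gamma_nat_sub_mul_Gamma_one_add_sub_nat (s : ℝ) (n : ℕ) :
    Gamma (n - s) * Gamma (1 + s - n) = (-1) ^ n * (Gamma (-s) * Gamma (1 + s)) := by
  have h₁ := Gamma_mul_Gamma_one_sub (n - s)
  have h₀ := Gamma_mul_Gamma_one_sub (-s)
  rw [show 1 - ((n : ℝ) - s) = 1 + s - n by ring,
    show π * ((n : ℝ) - s) = n * π - π * s by ring, sin_nat_mul_pi_sub] at h₁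
  rw [sub_neg_eq_add, mul_neg, sin_neg] at h₀
  rw [h₁, h₀]
  rcases neg_one_pow_eq_or ℝ n with h | h <;> simp [h, div_neg]

/-- The duplication formula, with argument centred at `s + 1 / 2`. -/
lemma four_rpow_mul_Gamma_half_add_mul_Gamma_one_add (s : ℝ) :
    4 ^ s * Gamma (1 / 2 + s) * Gamma (1 + s) = Gamma (2 * s + 1) * √π := by
  have h := Gamma_mul_Gamma_add_half (1 / 2 + s)
  rw [show 1 / 2 + s + 1 / 2 = 1 + s by ring, show 2 * (1 / 2 + s) = 2 * s + 1 by ring,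
    show 1 - (2 * s + 1) = -(2 * s) by ring, rpow_neg zero_le_two, rpow_mul zero_le_two,
    rpow_two, show (2 : ℝ) ^ 2 = 4 by norm_num] at h
  have h4 : (4 : ℝ) ^ s ≠ 0 := (rpow_pos_of_pos four_pos s).ne'
  rw [mul_assoc, h]
  field_simp

end Real

lemma fracKer_neg (s : ℝ) (k : ℤ) : fracKer s (-k) = fracKer s k := by
  simp [fracKer]

open Real in
lemma fracKer_natCast {s : ℝ} (hs : ∀ j : ℤ, s ≠ j) {n : ℕ} (hn : n ≠ 0) :
    fracKer s n =
      (-1) ^ (n + 1) * Gamma (2 * s + 1) / (Gamma (1 + s + n) * Gamma (1 + s - n)) := by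
  have h₁ : Gamma (-s) ≠ 0 := Gamma_ne_zero_of_not_int fun j h => hs (-j) (by
    push_cast; linarith)
  have h₂ : Gamma (1 + s - n) ≠ 0 := Gamma_ne_zero_of_not_int fun j h => hs (j + n - 1) (by
    push_cast; linarith)
  have h₃ : Gamma (1 + s + n) ≠ 0 := Gamma_ne_zero_of_not_int fun j h => hs (j - n - 1) (by
    push_cast; linarith)
  have hπ : √π ≠ 0 := (sqrt_pos.2 pi_pos).ne'
  have hr := Gamma_nat_sub_mul_Gamma_one_add_sub_nat s n
  have hd := four_rpow_mul_Gamma_half_add_mul_Gamma_one_add s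
  rw [fracKer, if_neg (by exact_mod_cast hn), Int.cast_natCast, Nat.abs_cast,
    show (n : ℝ) + 1 + s = 1 + s + n by ring,
    div_eq_div_iff (mul_ne_zero (mul_ne_zero hπ h₁) h₃) (mul_ne_zero h₃ h₂), pow_succ]
  linear_combination (-(4 ^ s * Gamma (1 / 2 + s) * Gamma (1 + s + n))) * hr -
    (-1) ^ n * Gamma (-s) * Gamma (1 + s + n) * hd

/-- For every `m ∈ ℕ`, every `s ∈ (m−1, m)`, and every `k ∈ ℤ` with
`k ≠ 0` it holds that `K_s(k) = (−1)^{k+1} Γ(2s+1) / (Γ(1+s+k) Γ(1+s−k))`;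
moreover `K_s(0) = 0`. -/
theorem stmt13 (m : ℕ) (hm : 1 ≤ m) (s : ℝ) (hs1 : (m : ℝ) - 1 < s) (hs2 : s < m) :
    (∀ k : ℤ, k ≠ 0 → fracKer s k =
      (-1 : ℝ) ^ (k + 1) * Real.Gamma (2 * s + 1) /
        (Real.Gamma (1 + s + (k : ℝ)) * Real.Gamma (1 + s - (k : ℝ)))) ∧
    fracKer s 0 = 0 := by
  have hs : ∀ j : ℤ, s ≠ j := by
    rintro j rfl
    have h₁ : (m : ℤ) - 1 < j := by exact_mod_cast hs1
    have h₂ : j < (m : ℤ) := by exact_mod_cast hs2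
    omega
  refine ⟨fun k hk => ?_, by simp [fracKer]⟩
  obtain ⟨n, rfl | rfl⟩ := k.eq_nat_or_neg
  · rw [fracKer_natCast hs (by simpa using hk)]
    norm_cast
  · have hsign : (-1 : ℝ) ^ (-(n : ℤ) + 1) = (-1) ^ (n + 1) := by
      rw [zpow_add₀ (by norm_num), zpow_neg, zpow_natCast, zpow_one, pow_succ, ← inv_pow]
      norm_num
    rw [fracKer_neg, fracKer_natCast hs (by simpa using hk), hsign, Int.cast_neg,
      Int.cast_natCast, sub_neg_eq_add, ← sub_eq_add_neg, mul_comm (Real.Gamma (1 + s - n))]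
end

section
/- For every m ∈ ℕ and every s ∈ (m−1, m) the family (K_s(k))_{k∈ℤ} is summable and Σ_{k∈ℤ} K_s(k) = 4^s Γ(1/2 + s) / (√π Γ(1 + s)). -/
open Filter Topology in
theorem tendsto_Gamma_sub_div_Gamma_add {s : ℝ} (hs : 0 < s) (hns : ∀ n : ℕ, s ≠ n) :
    Tendsto (fun n : ℕ => Real.Gamma (n + 1 - s) / Real.Gamma (n + 1 + s)) atTop (𝓝 0) := by
  have hprod : ∀ x : ℝ, (∀ n : ℕ, x ≠ -n) → ∀ n : ℕ,
      Real.Gamma (x + n) = (∏ j ∈ Finset.range n, (x + j)) * Real.Gamma x := by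
    intro x hx n
    induction n with
    | zero => simp
    | succ n ih =>
      have h : x + n ≠ 0 := fun h => hx n (by linarith)
      rw [Finset.prod_range_succ, mul_right_comm, ← ih, Nat.cast_succ, ← add_assoc,
        Real.Gamma_add_one h, mul_comm]
  have hpos : ∀ n : ℕ, s ≠ -n := fun n h => by
    have := n.cast_nonneg (α := ℝ)
    linarith
  have hneg : ∀ n : ℕ, -s ≠ -n := fun n h => hns n (neg_injective h)
  have hG := Real.Gamma_ne_zero hpos
  have hG' := Real.Gamma_ne_zero hneg
  have hlim := ((Real.GammaSeq_tendsto_Gamma s).div (Real.GammaSeq_tendsto_Gamma (-s)) hG').mul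
    (((tendsto_rpow_neg_atTop (y := 2 * s) (by positivity)).comp
      (tendsto_natCast_atTop_atTop (R := ℝ))).mul_const (Real.Gamma (-s) / Real.Gamma s))
  rw [zero_mul, mul_zero] at hlim
  refine hlim.congr' ?_
  filter_upwards [eventually_gt_atTop 0] with n hn
  have hn' : (0 : ℝ) < n := by exact_mod_cast hn
  have h1 := hprod s hpos (n + 1)
  have h2 := hprod (-s) hneg (n + 1)
  have e1 : (n : ℝ) + 1 - s = -s + (n + 1 : ℕ) := by push_cast; ring
  have e2 : (n : ℝ) + 1 + s = s + (n + 1 : ℕ) := by push_cast; ring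
  have p1 : ∏ j ∈ Finset.range (n + 1), (s + j) ≠ 0 :=
    Finset.prod_ne_zero_iff.2 fun j _ h => hpos j (by linarith)
  have p2 : ∏ j ∈ Finset.range (n + 1), (-s + j) ≠ 0 :=
    Finset.prod_ne_zero_iff.2 fun j _ h => hneg j (by linarith)
  have hr : (n : ℝ) ^ (2 * s) = n ^ s * n ^ s := by rw [← Real.rpow_add hn', two_mul]
  have hf : (n.factorial : ℝ) ≠ 0 := by positivity
  have hr' : (n : ℝ) ^ s ≠ 0 := by positivity
  simp only [Real.GammaSeq, Function.comp, Pi.div_apply]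
  rw [e1, e2, h1, h2, Real.rpow_neg hn'.le, Real.rpow_neg hn'.le, hr]
  field_simp

theorem hasSum_Gamma_sub_div_Gamma_add {s : ℝ} (hs : 0 < s) (hns : ∀ n : ℕ, s ≠ n) :
    HasSum (fun n : ℕ => Real.Gamma (n + 1 - s) / Real.Gamma (n + 1 + 1 + s))
      (Real.Gamma (1 - s) / (2 * s * Real.Gamma (1 + s))) := by
  set b : ℕ → ℝ := fun n => Real.Gamma (n + 1 - s) / Real.Gamma (n + 1 + s) with hb
  have hstep : ∀ n : ℕ, Real.Gamma (n + 1 - s) / Real.Gamma (n + 1 + 1 + s) =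
      -(2 * s)⁻¹ * (b (n + 1) - b n) := by
    intro n
    have h1 : (n : ℝ) + 1 - s ≠ 0 := fun h => hns (n + 1) (by push_cast; linarith)
    have h2 : (n : ℝ) + 1 + s ≠ 0 := by positivity
    have hG : Real.Gamma (n + 1 + s) ≠ 0 := (Real.Gamma_pos_of_pos (by positivity)).ne'
    have e1 : Real.Gamma (n + 1 + 1 - s) = (n + 1 - s) * Real.Gamma (n + 1 - s) := by
      rw [← Real.Gamma_add_one h1]; congr 1; ring
    have e2 : Real.Gamma (n + 1 + 1 + s) = (n + 1 + s) * Real.Gamma (n + 1 + s) := by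
      rw [← Real.Gamma_add_one h2]; congr 1; ring
    simp only [hb, Nat.cast_succ, e1, e2]
    field_simp
    ring
  have hsum : ∀ N : ℕ, ∑ n ∈ Finset.range N,
      Real.Gamma (n + 1 - s) / Real.Gamma (n + 1 + 1 + s) = -(2 * s)⁻¹ * (b N - b 0) := by
    intro N
    simp only [hstep, ← Finset.mul_sum, Finset.sum_range_sub]
  have hlim := ((tendsto_Gamma_sub_div_Gamma_add hs hns).sub_const (b 0)).const_mul (-(2 * s)⁻¹)
  have hval : -(2 * s)⁻¹ * (0 - b 0) = Real.Gamma (1 - s) / (2 * s * Real.Gamma (1 + s)) := by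
    simp only [hb, Nat.cast_zero, zero_add]
    field_simp
    ring
  rw [hval] at hlim
  refine (Summable.hasSum_iff_tendsto_nat ?_).2 (hlim.congr fun N => (hsum N).symm)
  obtain ⟨m, hm⟩ := exists_nat_ge s
  have hbpos : ∀ n : ℕ, 0 ≤ b (n + m) := fun n => by
    have : (0 : ℝ) ≤ n := n.cast_nonneg
    have h1 : (0 : ℝ) < (n + m : ℕ) + 1 - s := by push_cast; linarith
    exact div_nonneg (Real.Gamma_pos_of_pos h1).le (Real.Gamma_pos_of_pos (by positivity)).le
  rw [← summable_nat_add_iff m]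
  refine summable_of_sum_range_le (c := (2 * s)⁻¹ * b m) (fun n => ?_) fun N => ?_
  · have : (0 : ℝ) ≤ n := n.cast_nonneg
    have h1 : (0 : ℝ) < (n + m : ℕ) + 1 - s := by push_cast; linarith
    exact div_nonneg (Real.Gamma_pos_of_pos h1).le (Real.Gamma_pos_of_pos (by positivity)).le
  · simp only [hstep, ← Finset.mul_sum]
    have htel : ∑ n ∈ Finset.range N, (b (n + m + 1) - b (n + m)) = b (N + m) - b m := by
      simpa [add_right_comm] using Finset.sum_range_sub (fun n => b (n + m)) N
    rw [htel]
    have : 0 ≤ (2 * s)⁻¹ * b (N + m) := mul_nonneg (by positivity) (hbpos N)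
    linarith

/-- For every `m ∈ ℕ` and every `s ∈ (m−1, m)` the family
`(K_s(k))_{k∈ℤ}` is summable and `∑_{k∈ℤ} K_s(k) = 4^s Γ(1/2+s)/(√π Γ(1+s))`. -/
theorem stmt16 (m : ℕ) (hm : 1 ≤ m) (s : ℝ) (hs1 : (m : ℝ) - 1 < s) (hs2 : s < m) :
    HasSum (fun k : ℤ => fracKer s k)
      ((4 : ℝ) ^ s * Real.Gamma (1 / 2 + s) /
        (Real.sqrt Real.pi * Real.Gamma (1 + s))) := by
  have hm' : (1 : ℝ) ≤ m := by exact_mod_cast hm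
  have hs : 0 < s := by linarith
  have hns : ∀ n : ℕ, s ≠ n := by
    rintro n rfl
    have h1 : n < m := by exact_mod_cast hs2
    have h2 : m < n + 1 := by exact_mod_cast (by linarith : (m : ℝ) < n + 1)
    omega
  have hG : Real.Gamma (-s) ≠ 0 := Real.Gamma_ne_zero fun n h => hns n (neg_injective h)
  have hG1 : Real.Gamma (1 - s) = -s * Real.Gamma (-s) := by
    rw [← Real.Gamma_add_one (neg_ne_zero.2 hs.ne')]; congr 1; ring
  have hG2 : Real.Gamma (1 + s) ≠ 0 := (Real.Gamma_pos_of_pos (by positivity)).ne'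
  have hpi : Real.sqrt Real.pi ≠ 0 := by positivity
  have h := (hasSum_Gamma_sub_div_Gamma_add hs hns).mul_left
    (-((4 : ℝ) ^ s * Real.Gamma (1 / 2 + s)) / (Real.sqrt Real.pi * Real.Gamma (-s)))
  have habs : ∀ n : ℕ, |(n : ℝ) + 1| = n + 1 := fun n => abs_of_pos (by positivity)
  have hker : ∀ n : ℕ, fracKer s (n + 1) =
      -((4 : ℝ) ^ s * Real.Gamma (1 / 2 + s)) / (Real.sqrt Real.pi * Real.Gamma (-s)) *
        (Real.Gamma (n + 1 - s) / Real.Gamma (n + 1 + 1 + s)) := by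
    intro n
    rw [fracKer, if_neg (by omega)]
    push_cast
    rw [habs, div_mul_div_comm, neg_mul]
  have hker_neg : ∀ k : ℤ, fracKer s (-k) = fracKer s k := fun k => by simp [fracKer]
  have hpos : HasSum (fun n : ℕ => fracKer s (n + 1)) _ := h.congr_fun hker
  have hneg := hpos.congr_fun fun n : ℕ => hker_neg (n + 1)
  convert HasSum.of_add_one_of_neg_add_one hpos hneg using 1
  rw [hG1, fracKer, if_pos rfl]
  field_simp
  ring
end
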